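/- Under the SFA stationary measure π̃, the expected number of class-j customers at resource l equals (B_{lj} α_j / C_l) · 1/(1 − g_l): for every pair (l,j) ∈ K, the family m ↦ m(l,j) · π̃(m) over m : K → ℕ is summable with Σ_{m : K → ℕ} m(l,j) · π̃(m) = (B_{lj} α_j / C_l) / (1 − g_l). -/

import Mathlib

open scoped BigOperators

noncomputable section

/-- The set of resource-route pairs `(l,j)` actually used, i.e. with `B l j > 0`. -/
abbrev sfaK {L J : Type*} (B : L → J → ℝ) := {p : L × J // 0 < B p.1 p.2}

/-- The weight function of the SFA stationary measure:
`w(m) = ∏_l [ m_l! / ∏_j m_{lj}! ] · ∏_{(l,j) ∈ K} (B_{lj} α_j / C_l)^{m_{lj}}`. -/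
noncomputable def sfaW {L J : Type*} [Fintype L] [Fintype J]
    (B : L → J → ℝ) (C : L → ℝ) (α : J → ℝ) (m : sfaK B → ℕ) : ℝ :=
  (∏ l : L,
      ((Nat.factorial (∑ j : {j : J // 0 < B l j}, m ⟨(l, j.1), j.2⟩) : ℝ) /
        ∏ j : {j : J // 0 < B l j}, (Nat.factorial (m ⟨(l, j.1), j.2⟩) : ℝ))) *
    ∏ p : sfaK B, (B p.1.1 p.1.2 * α p.1.2 / C p.1.1) ^ m p

/-- The normalizing constant `Φ = ∏_l C_l / (C_l - Σ_j B_{lj} α_j)`. -/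
noncomputable def sfaPhi {L J : Type*} [Fintype L] [Fintype J]
    (B : L → J → ℝ) (C : L → ℝ) (α : J → ℝ) : ℝ :=
  ∏ l : L, C l / (C l - ∑ j : J, B l j * α j)

theorem sfa_pi_equiv.{u, v} (α β : Type u) [Fintype α] [Fintype β] (e : α ≃ β)
    (ih : ∀ (κ : α → Type v) (f : ∀ i, κ i → ℝ) (a : α → ℝ), (∀ i k, 0 ≤ f i k) →
      (∀ i, HasSum (f i) (a i)) → HasSum (fun m : ∀ i, κ i => ∏ i, f i (m i)) (∏ i, a i))
    (κ : β → Type v) (f : ∀ i, κ i → ℝ) (a : β → ℝ) (hf : ∀ i k, 0 ≤ f i k)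
    (h : ∀ i, HasSum (f i) (a i)) :
    HasSum (fun m : ∀ i, κ i => ∏ i, f i (m i)) (∏ i, a i) := by
  have := ih (fun i => κ (e i)) (fun i => f (e i)) (fun i => a (e i))
    (fun i k => hf _ _) (fun i => h _)
  rw [← (Equiv.piCongrLeft κ e).hasSum_iff, ← e.prod_comp]
  refine (congrArg (fun F => HasSum F _) (funext fun m => ?_)).mpr this
  simp only [Function.comp_apply]
  rw [← e.prod_comp]
  simp only [Equiv.piCongrLeft_apply_apply]

theorem sfa_pi_option.{u, v} (α : Type u) [Fintype α]
    (ih : ∀ (κ : α → Type v) (f : ∀ i, κ i → ℝ) (a : α → ℝ), (∀ i k, 0 ≤ f i k) →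
      (∀ i, HasSum (f i) (a i)) → HasSum (fun m : ∀ i, κ i => ∏ i, f i (m i)) (∏ i, a i))
    (κ : Option α → Type v) (f : ∀ i, κ i → ℝ) (a : Option α → ℝ) (hf : ∀ i k, 0 ≤ f i k)
    (h : ∀ i, HasSum (f i) (a i)) :
    HasSum (fun m : ∀ i, κ i => ∏ i, f i (m i)) (∏ i, a i) := by
  have h1 := ih (fun i => κ (some i)) (fun i => f (some i)) (fun i => a (some i))
    (fun i k => hf _ _) (fun i => h _)
  have h2 := (h none).mul h1 ((h none).summable.mul_of_nonneg h1.summable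
    (fun k => hf _ _) (fun m => Finset.prod_nonneg fun i _ => hf _ _))
  rw [← Equiv.piOptionEquivProd.symm.hasSum_iff, Fintype.prod_option]
  refine (congrArg (fun F => HasSum F _) (funext fun m => ?_)).mpr h2
  simp only [Function.comp_apply, Fintype.prod_option]
  rfl

theorem sfa_pi_empty.{u, v} (α : Type u) [Fintype α] [IsEmpty α]
    (κ : α → Type v) (f : ∀ i, κ i → ℝ) (a : α → ℝ) :
    HasSum (fun m : ∀ i, κ i => ∏ i, f i (m i)) (∏ i, a i) := by
  have := hasSum_unique (fun m : ∀ i : α, κ i => (1 : ℝ))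
  simpa only [Fintype.prod_empty] using this

/-- The product formula, as a property of the index type. -/
def SfaProdFormula.{u, v} (ι : Type u) [Fintype ι] : Prop :=
  ∀ (κ : ι → Type v) (f : ∀ i, κ i → ℝ) (a : ι → ℝ), (∀ i k, 0 ≤ f i k) →
      (∀ i, HasSum (f i) (a i)) → HasSum (fun m : ∀ i, κ i => ∏ i, f i (m i)) (∏ i, a i)

theorem sfaProdFormula_fin.{u, v} (n : ℕ) : SfaProdFormula.{u, v} (ULift.{u} (Fin n)) := by
  induction n with
  | zero => exact fun κ f a _ _ => sfa_pi_empty _ κ f a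
  | succ n ih =>
    have h1 : SfaProdFormula.{u, v} (Option (ULift.{u} (Fin n))) :=
      fun κ f a => sfa_pi_option _ ih κ f a
    have e : Option (ULift.{u} (Fin n)) ≃ ULift.{u} (Fin (n + 1)) :=
      Fintype.equivOfCardEq (by simp)
    exact fun κ f a => sfa_pi_equiv _ _ e h1 κ f a

/-- Finite products of nonnegative sums over a dependent function space. -/
theorem sfa_hasSum_pi_prod.{u, v} (ι : Type u) [Fintype ι] : SfaProdFormula.{u, v} ι := by
  have e : ULift.{u} (Fin (Fintype.card ι)) ≃ ι := Fintype.equivOfCardEq (by simp)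
  exact fun κ f a => sfa_pi_equiv _ _ e (sfaProdFormula_fin _) κ f a

/-- The weight at a single resource. -/
def sfaOne {ι : Type*} [Fintype ι] (x : ι → ℝ) (m : ι → ℕ) : ℝ :=
  ((Nat.factorial (∑ j, m j) : ℝ) / ∏ j, (Nat.factorial (m j) : ℝ)) * ∏ j, x j ^ m j

theorem sfaOne_nonneg {ι : Type*} [Fintype ι] {x : ι → ℝ} (hx : ∀ i, 0 ≤ x i) (m : ι → ℕ) :
    0 ≤ sfaOne x m :=
  mul_nonneg (by positivity) (Finset.prod_nonneg fun i _ => pow_nonneg (hx i) _)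

theorem sfaOne_hasSum {ι : Type*} [Fintype ι] {x : ι → ℝ} (hx : ∀ i, 0 ≤ x i)
    (c : ℕ → ℝ) (hc : ∀ n, 0 ≤ c n) (a : ℝ) (h : HasSum (fun n => c n * (∑ i, x i) ^ n) a) :
    HasSum (fun m : ι → ℕ => c (∑ i, m i) * sfaOne x m) a := by
  classical
  rw [← (Equiv.sigmaFiberEquiv (fun m : ι → ℕ => ∑ i, m i)).hasSum_iff]
  have hfib : ∀ n : ℕ, HasSum (fun m : {m : ι → ℕ // ∑ i, m i = n} =>
      c (∑ i, m.1 i) * sfaOne x m.1) (c n * (∑ i, x i) ^ n) := by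
    intro n
    rw [Finset.sum_pow_eq_sum_piAntidiag, Finset.mul_sum]
    have := (Finset.hasSum (Finset.piAntidiag (Finset.univ : Finset ι) n)
      (fun m => c (∑ i, m i) * sfaOne x m))
    have h3 : ∀ m : ι → ℕ, m ∈ Finset.piAntidiag (Finset.univ : Finset ι) n ↔ ∑ i, m i = n := by
      intro m; simp
    rw [← (Equiv.subtypeEquivRight h3).hasSum_iff]
    convert! this using 1
    refine Finset.sum_congr rfl fun m hm => ?_
    rw [h3] at hm
    rw [hm, sfaOne]
    congr 2
    rw [eq_div_iff (by positivity), mul_comm, ← Nat.multinomial_spec]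
    push_cast
    rfl
  refine HasSum.sigma_of_hasSum (g := fun n => c n * (∑ i, x i) ^ n) h hfib ?_
  rw [summable_sigma_of_nonneg]
  · exact ⟨fun n => (hfib n).summable, by
      refine h.summable.congr fun n => ?_
      exact ((hfib n).tsum_eq).symm⟩
  · exact fun m => mul_nonneg (hc _) (sfaOne_nonneg hx _)

theorem sfaOne_sum {ι : Type*} [Fintype ι] {x : ι → ℝ} (hx : ∀ i, 0 ≤ x i)
    (hs : ∑ i, x i < 1) : HasSum (sfaOne x) (1 / (1 - ∑ i, x i)) := by
  have hn : ‖∑ i, x i‖ < 1 := by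
    rwa [Real.norm_of_nonneg (Finset.sum_nonneg fun i _ => hx i)]
  have := sfaOne_hasSum hx (fun _ => 1) (fun _ => zero_le_one) (1 / (1 - ∑ i, x i))
    (by simpa using hasSum_geometric_of_norm_lt_one hn)
  simpa using this

theorem sfaOne_mean {ι : Type*} [Fintype ι] {x : ι → ℝ} (hx : ∀ i, 0 ≤ x i)
    (hs : ∑ i, x i < 1) (i : ι) :
    HasSum (fun m : ι → ℕ => (m i : ℝ) * sfaOne x m)
      ((1 / (1 - ∑ i, x i)) * (x i / (1 - ∑ i, x i))) := by
  classical
  have hn : ‖∑ i, x i‖ < 1 := by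
    rwa [Real.norm_of_nonneg (Finset.sum_nonneg fun i _ => hx i)]
  have h1 := (sfaOne_hasSum hx (fun n => (n : ℝ) + 1) (fun _ => by positivity)
    (1 / (1 - ∑ i, x i) ^ 2)
    (by simpa using hasSum_choose_mul_geometric_of_norm_lt_one 1 hn)).mul_left (x i)
  have hinj : Function.Injective (fun m : ι → ℕ => m + Pi.single i 1) :=
    fun a b h => add_right_cancel h
  rw [← hinj.hasSum_iff]
  · convert! h1 using 1
    · ext m
      have e1 : ∀ F : ι → ℕ → ℝ, ∏ j, F j ((m + Pi.single i 1 : ι → ℕ) j) =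
          F i (m i + 1) * ∏ j ∈ Finset.univ.erase i, F j (m j) := by
        intro F
        rw [← Finset.mul_prod_erase _ _ (Finset.mem_univ i)]
        congr 1
        · simp
        · refine Finset.prod_congr rfl fun j hj => ?_
          simp [Finset.ne_of_mem_erase hj]
      have e2 : ∑ j, (m + Pi.single i 1 : ι → ℕ) j = ∑ j, m j + 1 := by
        simp [Finset.sum_add_distrib]
      simp only [Function.comp_apply, sfaOne]
      rw [e2, e1 (fun _ n => (Nat.factorial n : ℝ)), e1 (fun j n => x j ^ n),
        ← Finset.mul_prod_erase _ (fun j => (Nat.factorial (m j) : ℝ)) (Finset.mem_univ i),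
        ← Finset.mul_prod_erase _ (fun j => x j ^ m j) (Finset.mem_univ i)]
      have hP : (∏ j ∈ Finset.univ.erase i, (Nat.factorial (m j) : ℝ)) ≠ 0 := by positivity
      have hQ : (Nat.factorial (m i) : ℝ) ≠ 0 := by positivity
      have hR : ((m i : ℝ) + 1) ≠ 0 := by positivity
      simp only [Nat.factorial_succ, Pi.add_apply, Pi.single_eq_same]
      push_cast
      field_simp
      ring
    · have : (1 - ∑ i, x i) ≠ 0 := by linarith
      field_simp
  · intro m hm
    have : m i = 0 := by
      by_contra h0
      apply hm
      refine ⟨m - Pi.single i 1, ?_⟩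
      ext j
      by_cases hj : j = i
      · subst hj; simp; omega
      · simp [hj]
    simp [this]

/-- Currying of states. -/
def sfaEquiv {L J : Type*} (B : L → J → ℝ) :
    (sfaK B → ℕ) ≃ (∀ l, {j : J // 0 < B l j} → ℕ) where
  toFun m l j := m ⟨(l, j.1), j.2⟩
  invFun m p := m p.1.1 ⟨p.1.2, p.2⟩
  left_inv _ := rfl
  right_inv _ := rfl

/-- The index set as a sigma type. -/
def sfaSigma {L J : Type*} (B : L → J → ℝ) :
    sfaK B ≃ (Σ l, {j : J // 0 < B l j}) where
  toFun p := ⟨p.1.1, ⟨p.1.2, p.2⟩⟩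
  invFun q := ⟨(q.1, q.2.1), q.2.2⟩
  left_inv _ := rfl
  right_inv _ := rfl

theorem sfaW_eq {L J : Type*} [Fintype L] [Fintype J]
    (B : L → J → ℝ) (C : L → ℝ) (α : J → ℝ) (m : sfaK B → ℕ) :
    sfaW B C α m = ∏ l, sfaOne (fun j : {j : J // 0 < B l j} => B l j * α j / C l)
      (sfaEquiv B m l) := by
  simp only [sfaW, sfaOne, Finset.prod_mul_distrib]
  congr 1
  rw [← (sfaSigma B).symm.prod_comp, Fintype.prod_sigma]
  rfl

/-- under the SFA stationary measure `π̃(m) = w(m)/Φ`, the expected number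
of class-`j` customers at resource `l` equals `(B_{lj} α_j / C_l) / (1 - g_l)`, for every
pair `(l,j) ∈ K`. -/
theorem sfa_expected_class_at_resource
    {L J : Type*} [Fintype L] [Fintype J] [Nonempty L] [Nonempty J]
    (B : L → J → ℝ) (C : L → ℝ) (α : J → ℝ)
    (hB : ∀ l j, 0 ≤ B l j) (hC : ∀ l, 0 < C l) (hα : ∀ j, 0 ≤ α j)
    (hg : ∀ l, (∑ j : J, B l j * α j) / C l < 1)
    (p : sfaK B) :
    Summable (fun m : sfaK B → ℕ => (m p : ℝ) * (sfaW B C α m / sfaPhi B C α)) ∧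
      (∑' m : sfaK B → ℕ, (m p : ℝ) * (sfaW B C α m / sfaPhi B C α)) =
        (B p.1.1 p.1.2 * α p.1.2 / C p.1.1) /
          (1 - (∑ j : J, B p.1.1 j * α j) / C p.1.1) := by
  classical
  obtain ⟨⟨l₀, j₀⟩, hp⟩ := p
  dsimp only at hp ⊢
  have hx : ∀ l, ∀ j : {j : J // 0 < B l j}, 0 ≤ B l j * α j / C l := fun l j =>
    div_nonneg (mul_nonneg (hB _ _) (hα _)) (hC l).le
  have hsum : ∀ l, ∑ j : {j : J // 0 < B l j}, B l j * α j / C l =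
      (∑ j : J, B l j * α j) / C l := by
    intro l
    rw [← Finset.sum_div]
    congr 1
    rw [← Finset.sum_subtype (Finset.univ.filter fun j => 0 < B l j) (by simp)
      (fun j => B l j * α j)]
    refine Finset.sum_subset (Finset.filter_subset _ _) fun j _ hj => ?_
    have : B l j = 0 := le_antisymm (by simpa using hj) (hB l j)
    simp [this]
  set g : L → ℝ := fun l => (∑ j : J, B l j * α j) / C l with hgdef
  have hg' : ∀ l, 1 - g l ≠ 0 := fun l => by have := hg l; simp only [hgdef]; linarith
  have hPhi : sfaPhi B C α = ∏ l, 1 / (1 - g l) := by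
    refine Finset.prod_congr rfl fun l _ => ?_
    have hCl := (hC l).ne'
    have h1 := hg' l
    have h2 : C l - ∑ j, B l j * α j = C l * (1 - g l) := by
      simp only [hgdef]; field_simp
    rw [h2]
    field_simp
  have hPhi0 : sfaPhi B C α ≠ 0 := by
    rw [hPhi]
    exact Finset.prod_ne_zero_iff.2 fun l _ => one_div_ne_zero (hg' l)
  let x : ∀ l, {j : J // 0 < B l j} → ℝ := fun l j => B l j * α j / C l
  let c : ∀ l, ({j : J // 0 < B l j} → ℕ) → ℝ := fun l m =>
    if h : l = l₀ then (m ⟨j₀, h ▸ hp⟩ : ℝ) else 1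
  let d : L → ℝ := fun l => if l = l₀ then (B l j₀ * α j₀ / C l) / (1 - g l) else 1
  have key := sfa_hasSum_pi_prod L (fun l => {j : J // 0 < B l j} → ℕ)
    (fun l m => c l m * sfaOne (x l) m) (fun l => 1 / (1 - g l) * d l)
    (fun l m => mul_nonneg (by dsimp only [c]; split_ifs <;> positivity)
      (sfaOne_nonneg (hx l) m))
    (fun l => by
      by_cases h : l = l₀
      · subst h
        have := sfaOne_mean (hx l) (by rw [hsum]; exact hg l) ⟨j₀, hp⟩
        rw [hsum] at this
        simpa [c, d] using this
      · have := sfaOne_sum (hx l) (by rw [hsum]; exact hg l)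
        rw [hsum] at this
        simpa [c, d, h] using this)
  rw [← (sfaEquiv B).hasSum_iff] at key
  have fin : HasSum (fun m : sfaK B → ℕ =>
      (m ⟨(l₀, j₀), hp⟩ : ℝ) * (sfaW B C α m / sfaPhi B C α))
      ((B l₀ j₀ * α j₀ / C l₀) / (1 - g l₀)) := by
    convert! key.div_const (sfaPhi B C α) using 1
    · ext m
      simp only [Function.comp_apply, Finset.prod_mul_distrib]
      rw [← mul_div_assoc, sfaW_eq]
      congr 2
      rw [Finset.prod_eq_single l₀]
      · simp [c, sfaEquiv]
      · intro l _ h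
        simp [c, h]
      · simp
    · rw [Finset.prod_mul_distrib, ← hPhi, mul_div_cancel_left₀ _ hPhi0]
      simp [d]
  exact ⟨fin.summable, fin.tsum_eq⟩
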